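/- Let P be a Wait-Only protocol with uncoverable state q_u and final state q_f ∈ Q_W, and let V_P be the associated VASS. If (s_0, 0) ⇝* (s_f, 0) in V_P, then there exist an initial configuration C of P and a configuration C' such that C →* C' and C'(e) = q_f for all e ∈ [1, ||C'||]. -/

import Mathlib

set_option maxHeartbeats 1000000

inductive Act (M : Type) where
  | send : M → Act M
  | recv : M → Act M

structure Protocol (Q M : Type) where
  qin : Q
  T : Set (Q × Act M × Q)

namespace Protocol

variable {Q M : Type}

/-- Messages receivable from state `q`. -/
def R (P : Protocol Q M) (q : Q) : Set M := {a | ∃ q', (q, Act.recv a, q') ∈ P.T}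

/-- `q` has an outgoing reception transition. -/
def isWaiting (P : Protocol Q M) (q : Q) : Prop := ∃ a q', (q, Act.recv a, q') ∈ P.T

/-- The set of waiting states. -/
def QW (P : Protocol Q M) : Set Q := {q | P.isWaiting q}

/-- The set of action states. -/
def QA (P : Protocol Q M) : Set Q := {q | ¬ P.isWaiting q}

/-- Wait-Only protocol: every state has no receptions or no broadcasts; the initial
state is an action state; there is no broadcast self-loop. -/
def WaitOnly (P : Protocol Q M) : Prop :=
  (∀ q : Q, ¬ P.isWaiting q ∨ ¬ ∃ a q', (q, Act.send a, q') ∈ P.T) ∧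
  ¬ P.isWaiting P.qin ∧
  ∀ q a, (q, Act.send a, q) ∉ P.T

/-- `qu` is an uncoverable state. -/
def Uncoverable (P : Protocol Q M) (qu : Q) : Prop :=
  (∀ q α q', (q, α, q') ∈ P.T → q ≠ qu ∧ q' ≠ qu) ∧ qu ≠ P.qin

/-- One broadcast step, performed by process `e` via transition `t`. -/
def Step (P : Protocol Q M) {n : ℕ} (e : Fin n) (t : Q × Act M × Q) (C C' : Fin n → Q) : Prop :=
  ∃ q a q', t = (q, Act.send a, q') ∧ t ∈ P.T ∧ C e = q ∧ C' e = q' ∧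
    ∀ e' : Fin n, e' ≠ e →
      ((C e', Act.recv a, C' e') ∈ P.T ∨ (a ∉ P.R (C e') ∧ C' e' = C e'))

def StepAny (P : Protocol Q M) {n : ℕ} (C C' : Fin n → Q) : Prop :=
  ∃ e t, P.Step e t C C'

def Reach (P : Protocol Q M) {n : ℕ} : (Fin n → Q) → (Fin n → Q) → Prop :=
  Relation.ReflTransGen P.StepAny

def Initial (P : Protocol Q M) {n : ℕ} (C : Fin n → Q) : Prop := ∀ e, C e = P.qin

end Protocol

/-- A finite or infinite execution: `len` is the number of configurations (`⊤` = infinite);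
configurations beyond the length are irrelevant. -/
structure Exec {Q M : Type} (P : Protocol Q M) (n : ℕ) where
  npos : 0 < n
  len : ℕ∞
  len_pos : 1 ≤ len
  conf : ℕ → Fin n → Q
  init : P.Initial (conf 0)
  step : ∀ i : ℕ, ((i : ℕ∞) + 1) < len → P.StepAny (conf i) (conf (i + 1))

namespace Exec

variable {Q M : Type} {P : Protocol Q M} {n : ℕ}

open Classical in
/-- First moment `k ≥ j` (within the execution) at which process `e` is in an action
state; `|ρ|` if there is none. -/
noncomputable def nextIdx (ρ : Exec P n) (j : ℕ) (e : Fin n) : ℕ∞ :=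
  if h : ∃ k : ℕ, j ≤ k ∧ (k : ℕ∞) < ρ.len ∧ ¬ P.isWaiting (ρ.conf k e)
  then (Nat.find h : ℕ∞)
  else ρ.len

open Classical in
/-- The next action state of process `e` after `j`; the uncoverable state `qu` if none. -/
noncomputable def nextSt (qu : Q) (ρ : Exec P n) (j : ℕ) (e : Fin n) : Q :=
  if h : ∃ k : ℕ, j ≤ k ∧ (k : ℕ∞) < ρ.len ∧ ¬ P.isWaiting (ρ.conf k e)
  then ρ.conf (Nat.find h) e
  else qu

noncomputable def next (qu : Q) (ρ : Exec P n) (j : ℕ) (e : Fin n) : Q × ℕ∞ :=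
  (nextSt qu ρ j e, nextIdx ρ j e)

/-- Well-formed executions. -/
def WellFormed (qu : Q) (ρ : Exec P n) : Prop :=
  ∀ i : ℕ, (i : ℕ∞) < ρ.len → ∀ e1 e2 : Fin n,
    ρ.conf i e1 = ρ.conf i e2 → P.isWaiting (ρ.conf i e1) →
    nextSt qu ρ i e1 = nextSt qu ρ i e2 →
    ∀ k : ℕ, i ≤ k → (k : ℕ∞) ≤ nextIdx ρ i e1 → ρ.conf k e1 = ρ.conf k e2

/-- The set of indices at which some process currently waiting will reach action state `qa`. -/
def nextSet (qu : Q) (ρ : Exec P n) (j : ℕ) (qa : Q) : Set ℕ :=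
  {i | ∃ e : Fin n, P.isWaiting (ρ.conf j e) ∧ next qu ρ j e = (qa, (i : ℕ∞))}

end Exec

structure VASS (L X : Type) where
  init : L
  Δ : Set (L × (X → ℤ) × L)

namespace VASS

variable {L X : Type}

/-- One VASS step (counters stay in ℕ by typing). -/
def Step (V : VASS L X) (c c' : L × (X → ℕ)) : Prop :=
  ∃ δ, (c.1, δ, c'.1) ∈ V.Δ ∧ ∀ x, (c'.2 x : ℤ) = (c.2 x : ℤ) + δ x

def Reach (V : VASS L X) : (L × (X → ℕ)) → (L × (X → ℕ)) → Prop :=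
  Relation.ReflTransGen V.Step

end VASS

/-- A summary: a print (set of waiting states), an exit state and an identifier. -/
structure Summary (Q : Type) where
  pr : Set Q
  exit : Q
  id : ℕ

namespace BP

variable {Q M : Type}

/-- `|Q_W|`. -/
noncomputable def nW (P : Protocol Q M) : ℕ := P.QW.ncard

def ValidSummary (P : Protocol Q M) (S : Summary Q) : Prop :=
  S.pr ⊆ P.QW ∧ S.exit ∈ P.QA ∧ 1 ≤ S.id ∧ S.id ≤ nW P + 1

/-- Coherent sets of summaries. -/
def Coherent (P : Protocol Q M) (SS : Set (Summary Q)) : Prop :=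
  (∀ S ∈ SS, ValidSummary P S) ∧
  ∀ S1 ∈ SS, ∀ S2 ∈ SS, S1 ≠ S2 → S1.exit = S2.exit →
    S1.id ≠ S2.id ∧ S1.pr ∩ S2.pr = ∅

/-- Labels of a set of summaries. -/
def labs (SS : Set (Summary Q)) : Set (Q × ℕ) := (fun S => (S.exit, S.id)) '' SS

/-- `σ` describes a legal reaction of each state of `pr` to the broadcast of `b`. -/
def RecvFun (P : Protocol Q M) (b : M) (pr : Set Q) (σ : Q → Q) : Prop :=
  ∀ p ∈ pr, (p, Act.recv b, σ p) ∈ P.T ∨ (b ∉ P.R p ∧ σ p = p)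

/-- `S ⟶^t S'`. -/
def SummStep (P : Protocol Q M) (t : Q × Act M × Q) (S S' : Summary Q) : Prop :=
  ∃ q b q', t = (q, Act.send b, q') ∧ t ∈ P.T ∧
    ∃ σ : Q → Q, RecvFun P b S.pr σ ∧ S'.exit = S.exit ∧ S'.id = S.id ∧
      S'.pr = σ '' S.pr ∧ σ '' S.pr ⊆ P.QW

/-- `S ⟶^{t,+q'} S'`. -/
def SummStepJoin (P : Protocol Q M) (t : Q × Act M × Q) (S S' : Summary Q) : Prop :=
  ∃ q b q', t = (q, Act.send b, q') ∧ t ∈ P.T ∧ q' ∈ P.QW ∧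
    ∃ σ : Q → Q, RecvFun P b S.pr σ ∧ S'.exit = S.exit ∧ S'.id = S.id ∧
      S'.pr = σ '' S.pr ∪ {q'} ∧ σ '' S.pr ∪ {q'} ⊆ P.QW

/-- `S ⟶^t Done`. -/
def SummStepDone (P : Protocol Q M) (t : Q × Act M × Q) (S : Summary Q) : Prop :=
  ∃ q b q', t = (q, Act.send b, q') ∧ t ∈ P.T ∧
    ∃ σ : Q → Q, RecvFun P b S.pr σ ∧ σ '' S.pr = {S.exit}

/-- `S` steps to `some S'` or to `Done` (encoded as `none`). -/
def stepsTo (P : Protocol Q M) (t : Q × Act M × Q) (S : Summary Q) :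
    Option (Summary Q) → Prop
  | some S' => SummStep P t S S'
  | none => SummStepDone P t S

inductive CtrBase (Q : Type) where
  | st : Q → CtrBase Q
  | sm : Q → ℕ → CtrBase Q

def ValidCtr (P : Protocol Q M) : CtrBase Q → Prop
  | .st q => q ∈ P.QA
  | .sm q k => q ∈ P.QA ∧ 1 ≤ k ∧ k ≤ nW P + 1

/-- The counters of the VASS built from `P`. -/
abbrev Ctr (P : Protocol Q M) := {x : CtrBase Q // ValidCtr P x}

open Classical in
/-- Characteristic (unit) vector of a counter. -/
noncomputable def chi (P : Protocol Q M) (x : CtrBase Q) : Ctr P → ℤ :=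
  fun y => if y.val = x then 1 else 0

/-- The relation `(SS, δ, SS') ∈ Δ_t`. -/
def DeltaT (P : Protocol Q M) (t : Q × Act M × Q) (SS : Set (Summary Q))
    (δ : Ctr P → ℤ) (SS' : Set (Summary Q)) : Prop :=
  Coherent P SS ∧ Coherent P SS' ∧
  ∃ q a q', t = (q, Act.send a, q') ∧ t ∈ P.T ∧
  ((q' ∈ P.QA ∧
      (∃ g : Summary Q → Option (Summary Q),
        (∀ S ∈ SS, stepsTo P t S (g S)) ∧
        SS' = {S' | ∃ S ∈ SS, g S = some S'}) ∧
      δ = fun y => chi P (.st q') y - chi P (.st q) y) ∨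
   (q' ∈ P.QW ∧
      ∃ S0 ∈ SS, ∃ S0' : Summary Q, SummStepJoin P t S0 S0' ∧
      (∃ g : Summary Q → Option (Summary Q),
        (∀ S ∈ SS, S ≠ S0 → stepsTo P t S (g S)) ∧
        SS' = insert S0' {S' | ∃ S ∈ SS, S ≠ S0 ∧ g S = some S'}) ∧
      δ = fun y => chi P (.sm S0.exit S0.id) y - chi P (.st q) y) ∨
   (q' ∈ P.QW ∧
      ∃ qa ∈ P.QA, ∃ k : ℕ, 1 ≤ k ∧ k ≤ nW P + 1 ∧ (qa, k) ∉ labs SS ∧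
      (∃ g : Summary Q → Option (Summary Q),
        (∀ S ∈ SS, stepsTo P t S (g S)) ∧
        SS' = insert (Summary.mk {q'} qa k) {S' | ∃ S ∈ SS, g S = some S'}) ∧
      δ = fun y => chi P (.sm qa k) y - chi P (.st q) y))

/-- The relation `(SS, δ, SS) ∈ Δ_e`. -/
def DeltaE (P : Protocol Q M) (SS : Set (Summary Q)) (δ : Ctr P → ℤ) : Prop :=
  Coherent P SS ∧ ∃ q ∈ P.QA, ∃ k : ℕ, 1 ≤ k ∧ k ≤ nW P + 1 ∧ (q, k) ∉ labs SS ∧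
    δ = fun y => chi P (.st q) y - chi P (.sm q k) y

/-- Locations of the VASS `V_P` (final state a waiting state). -/
inductive LocW (Q : Type) where
  | s0 : LocW Q
  | sf : LocW Q
  | co : Set (Summary Q) → LocW Q

/-- The VASS `V_P` associated to `P`, `q_u`, and a final waiting state `q_f`. -/
noncomputable def VP (P : Protocol Q M) (qu qf : Q) : VASS (LocW Q) (Ctr P) where
  init := .s0
  Δ := {d |
    d = (.s0, chi P (.st P.qin), .s0) ∨
    d = (.s0, 0, .co ∅) ∨
    d = (LocW.co {Summary.mk {qf} qu 1}, 0, .sf) ∨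
    d = (.sf, fun y => -(chi P (.sm qu 1) y), .sf) ∨
    (∃ t SS δ SS', d = (.co SS, δ, .co SS') ∧ DeltaT P t SS δ SS') ∨
    (∃ SS δ, d = (.co SS, δ, .co SS) ∧ DeltaE P SS δ)}

/-- `C ∈ ⟦(SS, v)⟧`. -/
def Implements (P : Protocol Q M) (SS : Set (Summary Q)) (v : Ctr P → ℕ)
    {n : ℕ} (C : Fin n → Q) : Prop :=
  ∃ f : Fin n → Ctr P,
    (∀ x : Ctr P, {e : Fin n | f e = x}.ncard = v x) ∧
    (∀ e q, (f e).val = CtrBase.st q → C e = q) ∧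
    (∀ e q k pr, (f e).val = CtrBase.sm q k → Summary.mk pr q k ∈ SS → C e ∈ pr ∪ {q}) ∧
    (∀ e q k, (f e).val = CtrBase.sm q k → (q, k) ∉ labs SS → C e = q)

end BP

open Classical in
/-- Fibre sizes after changing one value of a function on `Fin n`. -/
lemma ncard_fiber_update {X : Type} {n : ℕ} (f : Fin n → X) (e : Fin n) (y z : X) :
    (({e' | Function.update f e y e' = z}.ncard : ℕ) : ℤ) =
      ({e' | f e' = z}.ncard : ℤ) + ((if z = y then 1 else 0) - (if z = f e then 1 else 0)) := by
  have key (h : Fin n → X) : (({e' | h e' = z}.ncard : ℕ) : ℤ) =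
      (if z = h e then 1 else 0) + ∑ i ∈ Finset.univ.erase e, if z = h i then (1 : ℤ) else 0 := by
    rw [Finset.add_sum_erase _ (fun i => if z = h i then (1 : ℤ) else 0) (Finset.mem_univ e),
      Finset.sum_boole, Set.ncard_eq_toFinset_card']
    congr 2
    ext i
    simp [eq_comm]
  rw [key, key f, Finset.sum_congr rfl (g := fun i => if z = f i then (1 : ℤ) else 0)]
  · rw [Function.update_self]
    ring
  · intro i hi
    rw [Function.update_of_ne (Finset.ne_of_mem_erase hi)]

namespace Protocol

variable {Q M : Type} {P : Protocol Q M}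

lemma WaitOnly.sender_mem_QA (hWO : P.WaitOnly) {q q' : Q} {a : M}
    (h : (q, Act.send a, q') ∈ P.T) : q ∈ P.QA :=
  (hWO.1 q).resolve_right fun hn => hn ⟨a, q', h⟩

lemma not_mem_R_of_mem_QA {q : Q} (h : q ∈ P.QA) (a : M) : a ∉ P.R q :=
  fun ⟨q', hq'⟩ => h ⟨a, q', hq'⟩

lemma Uncoverable.mem_QA {qu : Q} (h : P.Uncoverable qu) : qu ∈ P.QA :=
  fun ⟨_, _, ht⟩ => (h.1 _ _ _ ht).1 rfl

lemma Uncoverable.ne_of_reach {qu : Q} (h : P.Uncoverable qu) {n : ℕ} {C C' : Fin n → Q}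
    (hC : P.Initial C) (hr : P.Reach C C') (e : Fin n) : C' e ≠ qu := by
  induction hr generalizing e with
  | refl => rw [hC e]; exact h.2.symm
  | tail _ hs ih =>
    obtain ⟨e₀, t, q, a, q', rfl, ht, -, h1, h2⟩ := hs
    by_cases he : e = e₀
    · rw [he, h1]
      exact (h.1 _ _ _ ht).2
    · rcases h2 e he with h3 | h3
      · exact (h.1 _ _ _ h3).2
      · rw [h3.2]
        exact ih e

end Protocol

namespace BP

variable {Q M : Type} {P : Protocol Q M}

lemma Coherent.eq_of_label {SS : Set (Summary Q)} (h : Coherent P SS) {S₁ S₂ : Summary Q}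
    (h₁ : S₁ ∈ SS) (h₂ : S₂ ∈ SS) (he : S₁.exit = S₂.exit) (hi : S₁.id = S₂.id) : S₁ = S₂ := by
  by_contra hne
  exact (h.2 S₁ h₁ S₂ h₂ hne he).1 hi

lemma stepsTo.exists_recvFun {q q' : Q} {a : M} {S : Summary Q} {o : Option (Summary Q)}
    (h : stepsTo P (q, Act.send a, q') S o) :
    ∃ σ : Q → Q, RecvFun P a S.pr σ ∧
      (∀ S', o = some S' → S'.exit = S.exit ∧ S'.id = S.id ∧ S'.pr = σ '' S.pr) ∧
      (o = none → σ '' S.pr = {S.exit}) := by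
  cases o with
  | none =>
    obtain ⟨_, b, _, ht, -, σ, hσ, h1⟩ := h
    cases ht
    exact ⟨σ, hσ, by simp, fun _ => h1⟩
  | some S' =>
    obtain ⟨_, b, _, ht, -, σ, hσ, h1, h2, h3, -⟩ := h
    cases ht
    refine ⟨σ, hσ, ?_, by simp⟩
    rintro _ ⟨⟩
    exact ⟨h1, h2, h3⟩

lemma exists_mem_of_chi_pos {n : ℕ} {v v' : Ctr P → ℕ} {f : Fin n → Ctr P}
    (hf : ∀ x : Ctr P, {e : Fin n | f e = x}.ncard = v x) {x y : CtrBase Q}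
    (hx : ValidCtr P x) (hxy : y ≠ x)
    (hv : ∀ z, (v' z : ℤ) = (v z : ℤ) + (chi P y z - chi P x z)) :
    ∃ e, (f e).val = x := by
  have h := hv ⟨x, hx⟩
  simp only [chi, if_neg hxy.symm, if_true] at h
  have hpos : 0 < {e : Fin n | f e = ⟨x, hx⟩}.ncard := by
    rw [hf]
    omega
  obtain ⟨e, he⟩ := (Set.ncard_pos).1 hpos
  exact ⟨e, by rw [show f e = ⟨x, hx⟩ from he]⟩

lemma ncard_update_chi {n : ℕ} {v v' : Ctr P → ℕ} {f : Fin n → Ctr P}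
    (hf : ∀ x : Ctr P, {e : Fin n | f e = x}.ncard = v x) {x : CtrBase Q} (y : Ctr P)
    {e : Fin n} (he : (f e).val = x)
    (hv : ∀ z, (v' z : ℤ) = (v z : ℤ) + (chi P y.val z - chi P x z)) (z : Ctr P) :
    {e' | Function.update f e y e' = z}.ncard = v' z := by
  classical
  have h := ncard_fiber_update f e y z
  rw [hf z] at h
  have hz := hv z
  simp only [chi, ← he, ← Subtype.ext_iff] at hz
  zify
  rw [h, hz]
  congr

/-- A broadcast in which every process of an active summary reacts as prescribed by `τ`, and
the sender moves to counter `y`. -/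
lemma Implements.broadcast (hWO : P.WaitOnly) {SS SS' : Set (Summary Q)}
    {v v' : Ctr P → ℕ} {n : ℕ} {C : Fin n → Q}
    (hC : Implements P SS v C) {q q' : Q} {a : M} (ht : (q, Act.send a, q') ∈ P.T)
    (y : CtrBase Q) (hy : ValidCtr P y) (hyq : y ≠ .st q)
    (hv : ∀ z, (v' z : ℤ) = (v z : ℤ) + (chi P y z - chi P (.st q) z))
    (τ : Summary Q → Q → Q) (hτ : ∀ S ∈ SS, RecvFun P a S.pr (τ S))
    (hkeep : ∀ S ∈ SS, ∀ S' ∈ SS', S'.exit = S.exit → S'.id = S.id → τ S '' S.pr ⊆ S'.pr)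
    (hdone : ∀ S ∈ SS, (S.exit, S.id) ∉ labs SS' → τ S '' S.pr ⊆ {S.exit})
    (hyst : ∀ p, y = .st p → q' = p)
    (hysm : ∀ S' ∈ SS', y = .sm S'.exit S'.id → q' ∈ S'.pr)
    (hylab : ∀ p k, y = .sm p k → (p, k) ∈ labs SS') :
    ∃ (e : Fin n) (C' : Fin n → Q),
      P.Step e (q, Act.send a, q') C C' ∧ Implements P SS' v' C' := by
  obtain ⟨f, hcount, hst, hsm, hfree⟩ := hC
  obtain ⟨e, he⟩ := exists_mem_of_chi_pos hcount (x := .st q) (hWO.sender_mem_QA ht) hyq hv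
  have hreact (e' : Fin n) : ∃ c : Q, ((C e', Act.recv a, c) ∈ P.T ∨ (a ∉ P.R (C e') ∧ c = C e')) ∧
      (∀ p, (f e').val = .st p → c = p) ∧
      (∀ p k, (f e').val = .sm p k →
        c = p ∨ ∃ S ∈ SS, S.exit = p ∧ S.id = k ∧ c ∈ τ S '' S.pr) := by
    have hval := (f e').2
    cases hx : (f e').val with
    | st p =>
      rw [hx] at hval
      have hp := hst e' p hx
      refine ⟨p, Or.inr ⟨hp ▸ P.not_mem_R_of_mem_QA hval a, hp.symm⟩, ?_, by simp⟩
      rintro _ ⟨⟩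
      rfl
    | sm p k =>
      rw [hx] at hval
      have hstay (hp : C e' = p) : a ∉ P.R (C e') ∧ p = C e' :=
        ⟨hp ▸ P.not_mem_R_of_mem_QA hval.1 a, hp.symm⟩
      by_cases hl : (p, k) ∈ labs SS
      · obtain ⟨⟨pr, p, k⟩, hS, ⟨⟩⟩ := hl
        rcases hsm e' p k pr hx hS with hp | hp
        · refine ⟨τ ⟨pr, p, k⟩ (C e'), hτ _ hS _ hp, by simp, ?_⟩
          rintro _ _ ⟨⟩
          exact Or.inr ⟨_, hS, rfl, rfl, Set.mem_image_of_mem _ hp⟩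
        · refine ⟨p, Or.inr (hstay hp), by simp, ?_⟩
          rintro _ _ ⟨⟩
          exact Or.inl rfl
      · refine ⟨p, Or.inr (hstay (hfree e' p k hx hl)), by simp, ?_⟩
        rintro _ _ ⟨⟩
        exact Or.inl rfl
  choose D hD hDst hDsm using hreact
  refine ⟨e, Function.update D e q',
    ⟨q, a, q', rfl, ht, hst e q he, Function.update_self .., fun e' he' => ?_⟩,
    Function.update f e ⟨y, hy⟩, ncard_update_chi hcount ⟨y, hy⟩ he hv, ?_, ?_, ?_⟩
  · rw [Function.update_of_ne he']
    exact hD e'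
  · intro e' p hp
    by_cases he' : e' = e
    · subst he'
      rw [Function.update_self] at hp ⊢
      exact hyst p hp
    · rw [Function.update_of_ne he'] at hp ⊢
      exact hDst e' p hp
  · intro e' p k pr hp hS'
    by_cases he' : e' = e
    · subst he'
      rw [Function.update_self] at hp ⊢
      exact Or.inl (hysm _ hS' hp)
    · rw [Function.update_of_ne he'] at hp ⊢
      rcases hDsm e' p k hp with h | ⟨S, hS, rfl, rfl, h⟩
      · exact Or.inr h
      · exact Or.inl (hkeep S hS _ hS' rfl rfl h)
  · intro e' p k hp hl
    by_cases he' : e' = e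
    · subst he'
      rw [Function.update_self] at hp
      exact absurd (hylab p k hp) hl
    · rw [Function.update_of_ne he'] at hp ⊢
      rcases hDsm e' p k hp with h | ⟨S, hS, rfl, rfl, h⟩
      · exact h
      · exact hdone S hS hl h

/-- Soundness of the broadcast transitions of `V_P`. -/
lemma Implements.deltaT (hWO : P.WaitOnly) {SS SS' : Set (Summary Q)} {δ : Ctr P → ℤ}
    {t : Q × Act M × Q} (hΔ : DeltaT P t SS δ SS') {v v' : Ctr P → ℕ} {n : ℕ} {C : Fin n → Q}
    (hC : Implements P SS v C) (hv : ∀ z, (v' z : ℤ) = (v z : ℤ) + δ z) :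
    ∃ (e : Fin n) (C' : Fin n → Q), P.Step e t C C' ∧ Implements P SS' v' C' := by
  classical
  obtain ⟨hSS, hSS', q, a, q', rfl, ht, hcase⟩ := hΔ
  have : Nonempty Q := ⟨q⟩
  rcases hcase with ⟨hq', ⟨g, hg, hSS'eq⟩, rfl⟩ | ⟨hq', S₀, hS₀, S₀', hjoin, ⟨g, hg, hSS'eq⟩, rfl⟩ |
    ⟨hq', p₀, hp₀, k₀, hk₁, hk₂, hnew, ⟨g, hg, hSS'eq⟩, rfl⟩
  · choose! τ hτ hsome hnone using fun S hS => (hg S hS).exists_recvFun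
    refine hC.broadcast hWO ht (.st q') hq' ?_ hv τ hτ ?_ ?_ (by simp) (by simp) (by simp)
    · rintro ⟨⟩
      exact hWO.2.2 _ _ ht
    · rintro S hS S' hS' h1 h2
      rw [hSS'eq] at hS'
      obtain ⟨S₁, hS₁, hgS₁⟩ := hS'
      obtain ⟨h3, h4, h5⟩ := hsome S₁ hS₁ S' hgS₁
      rw [hSS.eq_of_label hS hS₁ (h1.symm.trans h3) (h2.symm.trans h4), h5]
    · intro S hS hl
      cases hgS : g S with
      | none => exact (hnone S hS hgS).le
      | some S' =>
        obtain ⟨h3, h4, -⟩ := hsome S hS S' hgS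
        exact absurd ⟨S', hSS'eq ▸ ⟨S, hS, hgS⟩, by simp [h3, h4]⟩ hl
  · obtain ⟨_, b, _, heq, -, -, σ₀, hσ₀, hex, hid, hpr, -⟩ := hjoin
    cases heq
    choose! τ hτ hsome hnone using fun S hS hne => (hg S hS hne).exists_recvFun
    have hS₀' : S₀' ∈ SS' := hSS'eq ▸ Set.mem_insert ..
    have hlab₀ : (S₀.exit, S₀.id) ∈ labs SS' := ⟨S₀', hS₀', by simp [hex, hid]⟩
    have hval := hSS.1 S₀ hS₀
    refine hC.broadcast hWO ht (.sm S₀.exit S₀.id) ⟨hval.2.1, hval.2.2⟩ (by simp) hv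
      (fun S => if S = S₀ then σ₀ else τ S) ?_ ?_ ?_ (by simp) ?_ ?_
    · intro S hS
      by_cases h : S = S₀
      · subst h
        simpa using hσ₀
      · simpa [h] using hτ S hS h
    · intro S hS S' hS' h1 h2
      by_cases h : S = S₀
      · subst h
        rw [hSS'.eq_of_label hS' hS₀' (h1.trans hex.symm) (h2.trans hid.symm), hpr]
        simp
      · simp only [if_neg h]
        rw [hSS'eq] at hS'
        rcases hS' with rfl | ⟨S₁, hS₁, hne, hgS₁⟩
        · exact absurd (hSS.eq_of_label hS hS₀ (h1.symm.trans hex) (h2.symm.trans hid)) h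
        · obtain ⟨h3, h4, h5⟩ := hsome S₁ hS₁ hne S' hgS₁
          rw [hSS.eq_of_label hS hS₁ (h1.symm.trans h3) (h2.symm.trans h4), h5]
    · intro S hS hl
      by_cases h : S = S₀
      · subst h
        exact absurd hlab₀ hl
      · simp only [if_neg h]
        cases hgS : g S with
        | none => exact (hnone S hS h hgS).le
        | some S' =>
          obtain ⟨h3, h4, -⟩ := hsome S hS h S' hgS
          exact absurd ⟨S', hSS'eq ▸ Or.inr ⟨S, hS, h, hgS⟩, by simp [h3, h4]⟩ hl
    · intro S' hS' h
      simp only [CtrBase.sm.injEq] at h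
      rw [hSS'.eq_of_label hS' hS₀' (h.1.symm.trans hex.symm) (h.2.symm.trans hid.symm), hpr]
      exact Or.inr rfl
    · rintro _ _ ⟨⟩
      exact hlab₀
  · choose! τ hτ hsome hnone using fun S hS => (hg S hS).exists_recvFun
    have hmem : Summary.mk {q'} p₀ k₀ ∈ SS' := hSS'eq ▸ Set.mem_insert ..
    refine hC.broadcast hWO ht (.sm p₀ k₀) ⟨hp₀, hk₁, hk₂⟩ (by simp) hv τ hτ ?_ ?_
      (by simp) ?_ ?_
    · rintro S hS S' hS' h1 h2
      rw [hSS'eq] at hS'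
      rcases hS' with rfl | ⟨S₁, hS₁, hgS₁⟩
      · exact absurd ⟨S, hS, by simp [← h1, ← h2]⟩ hnew
      · obtain ⟨h3, h4, h5⟩ := hsome S₁ hS₁ S' hgS₁
        rw [hSS.eq_of_label hS hS₁ (h1.symm.trans h3) (h2.symm.trans h4), h5]
    · intro S hS hl
      cases hgS : g S with
      | none => exact (hnone S hS hgS).le
      | some S' =>
        obtain ⟨h3, h4, -⟩ := hsome S hS S' hgS
        exact absurd ⟨S', hSS'eq ▸ Or.inr ⟨S, hS, hgS⟩, by simp [h3, h4]⟩ hl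
    · intro S' hS' h
      simp only [CtrBase.sm.injEq] at h
      rw [hSS'.eq_of_label hS' hmem h.1.symm h.2.symm]
      rfl
    · rintro _ _ ⟨⟩
      exact ⟨_, hmem, rfl⟩

/-- Soundness of the transitions releasing a process from a finished summary. -/
lemma Implements.deltaE {SS : Set (Summary Q)} {δ : Ctr P → ℤ} (hΔ : DeltaE P SS δ)
    {v v' : Ctr P → ℕ} {n : ℕ} {C : Fin n → Q} (hC : Implements P SS v C)
    (hv : ∀ z, (v' z : ℤ) = (v z : ℤ) + δ z) : Implements P SS v' C := by
  obtain ⟨-, q, hq, k, hk₁, hk₂, hl, rfl⟩ := hΔ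
  obtain ⟨f, hcount, hst, hsm, hfree⟩ := hC
  obtain ⟨e, he⟩ := exists_mem_of_chi_pos hcount (x := .sm q k) ⟨hq, hk₁, hk₂⟩ (by simp) hv
  refine ⟨Function.update f e ⟨.st q, hq⟩, ncard_update_chi hcount ⟨.st q, hq⟩ he hv, ?_, ?_, ?_⟩
  · intro e' p hp
    by_cases he' : e' = e
    · subst he'
      rw [Function.update_self] at hp
      cases hp
      exact hfree e' q k he hl
    · rw [Function.update_of_ne he'] at hp
      exact hst e' p hp
  · intro e' p k' pr hp
    by_cases he' : e' = e
    · subst he'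
      simp at hp
    · rw [Function.update_of_ne he'] at hp
      exact hsm e' p k' pr hp
  · intro e' p k' hp
    by_cases he' : e' = e
    · subst he'
      simp at hp
    · rw [Function.update_of_ne he'] at hp
      exact hfree e' p k' hp

lemma implements_const {v : Ctr P → ℕ} (hin : P.qin ∈ P.QA)
    (hv : ∀ x : Ctr P, x.val ≠ .st P.qin → v x = 0) :
    Implements P ∅ v (fun _ : Fin (v ⟨.st P.qin, hin⟩) => P.qin) := by
  refine ⟨fun _ => ⟨.st P.qin, hin⟩, fun x => ?_, fun e q h => ?_, by simp, by simp⟩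
  · by_cases hx : x.val = .st P.qin
    · obtain rfl : x = ⟨.st P.qin, hin⟩ := Subtype.ext hx
      simp [Set.ncard_univ]
    · rw [hv x hx]
      have : (⟨.st P.qin, hin⟩ : Ctr P) ≠ x := fun h => hx (h ▸ rfl)
      simp [this]
  · cases h
    rfl

/-- The invariant relating configurations of `V_P` to executions of `P`. -/
def SoundInv (P : Protocol Q M) (qu qf : Q) (c : LocW Q × (Ctr P → ℕ)) : Prop :=
  match c.1 with
  | .s0 => ∀ x : Ctr P, x.val ≠ .st P.qin → c.2 x = 0
  | .co SS => ∃ (n : ℕ) (C : Fin n → Q), (SS = ∅ ∨ 0 < n) ∧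
      P.Reach (fun _ => P.qin) C ∧ Implements P SS c.2 C
  | .sf => ∃ (n : ℕ) (C : Fin n → Q), 0 < n ∧ P.Reach (fun _ => P.qin) C ∧
      ((∀ x : Ctr P, x.val ≠ .sm qu 1 → c.2 x = 0) → ∀ e, C e = qf)

lemma SoundInv.step {qu qf : Q} (hWO : P.WaitOnly) (hqu : P.Uncoverable qu)
    {c c' : LocW Q × (Ctr P → ℕ)} (hc : SoundInv P qu qf c) (hs : (VP P qu qf).Step c c') :
    SoundInv P qu qf c' := by
  obtain ⟨l, v⟩ := c
  obtain ⟨l', v'⟩ := c'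
  obtain ⟨δ, hδ, hv⟩ := hs
  rcases hδ with h | h | h | h | ⟨t, SS, _, SS', h, hΔ⟩ | ⟨SS, _, h, hΔ⟩ <;> cases h
  · intro x hx
    have h := hv x
    have h0 : v x = 0 := hc x hx
    change v' x = 0
    simp only [chi, if_neg hx] at h
    omega
  · obtain rfl : v' = v := funext fun x => by simpa using hv x
    exact ⟨_, _, Or.inl rfl, .refl, implements_const hWO.2.1 hc⟩
  · obtain rfl : v' = v := funext fun x => by simpa using hv x
    obtain ⟨n, C, hn, hr, f, hcount, -, hsm, -⟩ := hc
    refine ⟨n, C, hn.resolve_left (Set.singleton_ne_empty _), hr, fun hzero e => ?_⟩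
    have he : (f e).val = .sm qu 1 := by
      by_contra hne
      have h := hcount (f e)
      rw [hzero _ hne, Set.ncard_eq_zero] at h
      exact Set.notMem_empty e (h ▸ rfl)
    exact (hsm e qu 1 {qf} he rfl).resolve_right (hqu.ne_of_reach (fun _ => rfl) hr e)
  · obtain ⟨n, C, hn, hr, h⟩ := hc
    refine ⟨n, C, hn, hr, fun hzero => h fun x hx => ?_⟩
    have h1 := hv x
    have h0 : v' x = 0 := hzero x hx
    change v x = 0
    simp only [chi, if_neg hx] at h1
    omega
  · obtain ⟨n, C, -, hr, hC⟩ := hc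
    obtain ⟨e, C', hstep, hC'⟩ := hC.deltaT hWO hΔ hv
    exact ⟨n, C', Or.inr e.pos, hr.tail ⟨e, t, hstep⟩, hC'⟩
  · obtain ⟨n, C, hn, hr, hC⟩ := hc
    exact ⟨n, C, hn, hr, hC.deltaE hΔ hv⟩

end BP

open BP in
/-- **Soundness of the VASS construction.** If `(s_0, 0) ⇝* (s_f, 0)` in `V_P`, then
some reachable configuration of `P` puts every process on `q_f`. -/
theorem vass_soundness {Q M : Type} [Fintype Q] [Fintype M]
    (P : Protocol Q M) (qu qf : Q)
    (hWO : P.WaitOnly) (hqu : P.Uncoverable qu) (hqf : qf ∈ P.QW)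
    (hreach : (VP P qu qf).Reach (LocW.s0, 0) (LocW.sf, 0)) :
    ∃ (n : ℕ), 0 < n ∧ ∃ C C' : Fin n → Q,
      P.Initial C ∧ P.Reach C C' ∧ ∀ e, C' e = qf := by
  suffices h : SoundInv P qu qf (LocW.sf, 0) by
    obtain ⟨n, C, hn, hr, hC⟩ := h
    exact ⟨n, hn, _, C, fun _ => rfl, hr, hC fun _ _ => rfl⟩
  have h0 : SoundInv P qu qf (LocW.s0, 0) := fun _ _ => rfl
  exact hreach.head_induction_on
    (motive := fun c _ => SoundInv P qu qf c → SoundInv P qu qf (LocW.sf, 0))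
    id (fun hs _ ih hc => ih (hc.step hWO hqu hs)) h0
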